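/- Let I_1, …, I_r be ideals in R = ℂ[∂_1,…,∂_n] and let ω ∈ ℝ^n be a weight vector. If f ∈ R is ω-homogeneous (all monomials of f have the same ω-weight) and f ∈ in_ω(I_j) for every j = 1,…,r, then f^r ∈ in_ω(⋂_{j=1}^r I_j). Consequently ⋂_{j=1}^r in_ω(I_j) ⊆ √(in_ω(⋂_{j=1}^r I_j)). -/

import Mathlib

open MvPolynomial

noncomputable section

/-- The `ω`-weight of an exponent vector `u`, namely `ω · u`. -/
def wt {n : ℕ} (ω : Fin n → ℝ) (u : Fin n →₀ ℕ) : ℝ := ∑ i, ω i * (u i : ℝ)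

open scoped Classical in
/-- The initial form `in_ω(f)`: the sum of the terms of `f` whose `ω`-weight is maximal
among the exponents appearing in `f`.  (For `f = 0` this is `0`.) -/
def initialForm {n : ℕ} (ω : Fin n → ℝ) (f : MvPolynomial (Fin n) ℂ) :
    MvPolynomial (Fin n) ℂ :=
  ∑ u ∈ f.support.filter (fun u => ∀ v ∈ f.support, wt ω v ≤ wt ω u),
    monomial u (f.coeff u)

/-- The initial ideal `in_ω(I)`, generated by the initial forms of the nonzero elements
of `I`. -/
def initialIdeal {n : ℕ} (ω : Fin n → ℝ) (I : Ideal (MvPolynomial (Fin n) ℂ)) :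
    Ideal (MvPolynomial (Fin n) ℂ) :=
  Ideal.span { g | ∃ f ∈ I, f ≠ 0 ∧ g = initialForm ω f }

/-- `f` is `ω`-homogeneous: all monomials occurring in `f` have the same `ω`-weight. -/
def IsWHomogeneous {n : ℕ} (ω : Fin n → ℝ) (f : MvPolynomial (Fin n) ℂ) : Prop :=
  ∀ u ∈ f.support, ∀ v ∈ f.support, wt ω u = wt ω v

def Lead {n : ℕ} (ω : Fin n → ℝ) (d : ℝ) (f g : MvPolynomial (Fin n) ℂ) : Prop :=
  ∀ u, (d < wt ω u → g.coeff u = 0) ∧ (wt ω u = d → g.coeff u = f.coeff u)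

def Hom' {n : ℕ} (ω : Fin n → ℝ) (d : ℝ) (f : MvPolynomial (Fin n) ℂ) : Prop :=
  ∀ u, wt ω u ≠ d → f.coeff u = 0

lemma wt_add {n : ℕ} (ω : Fin n → ℝ) (u v : Fin n →₀ ℕ) :
    wt ω (u + v) = wt ω u + wt ω v := by
  simp [wt, mul_add, Finset.sum_add_distrib]

lemma coeff_initialForm {n : ℕ} (ω : Fin n → ℝ) (f : MvPolynomial (Fin n) ℂ) (u : Fin n →₀ ℕ)
    [Decidable (∀ v ∈ f.support, wt ω v ≤ wt ω u)] :
    (initialForm ω f).coeff u = if (∀ v ∈ f.support, wt ω v ≤ wt ω u) then f.coeff u else 0 := by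
  classical
  unfold initialForm
  rw [coeff_sum]
  simp only [coeff_monomial]
  rw [Finset.sum_ite_eq']
  by_cases h : f.coeff u = 0
  · simp [h]
  · simp only [Finset.mem_filter, mem_support_iff, ne_eq, h, not_false_eq_true, true_and]

lemma lead_of_mem {n : ℕ} (ω : Fin n → ℝ) (I : Ideal (MvPolynomial (Fin n) ℂ))
    (f : MvPolynomial (Fin n) ℂ) (hf : f ∈ initialIdeal ω I) :
    ∀ d, ∃ g ∈ I, Lead ω d f g := by
  classical
  unfold initialIdeal at hf
  induction hf using Submodule.span_induction with
  | mem x hx =>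
    obtain ⟨f, hfI, hf0, rfl⟩ := hx
    intro d
    obtain ⟨m, hm, hmax⟩ := Finset.exists_max_image f.support (wt ω) (by simpa using hf0)
    by_cases hd : wt ω m = d
    · refine ⟨f, hfI, fun u => ⟨fun hu => ?_, fun hu => ?_⟩⟩
      · by_contra hc
        have := hmax u (by simpa using hc)
        linarith
      · rw [coeff_initialForm, if_pos]
        intro v hv
        have := hmax v hv
        linarith
    · refine ⟨0, I.zero_mem, fun u => ⟨fun hu => by simp, fun hu => ?_⟩⟩
      rw [coeff_initialForm]
      split_ifs with h
      · by_contra hc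
        have h1 := hmax u (by simpa using Ne.symm hc)
        have h2 := h m hm
        exact hd (by linarith)
      · simp
  | zero => exact fun d => ⟨0, I.zero_mem, fun u => by simp⟩
  | add x y _ _ hx hy =>
    intro d
    obtain ⟨a, ha, ha'⟩ := hx d
    obtain ⟨b, hb, hb'⟩ := hy d
    refine ⟨a + b, I.add_mem ha hb, fun u => ⟨fun hu => ?_, fun hu => ?_⟩⟩
    · rw [coeff_add, (ha' u).1 hu, (hb' u).1 hu, add_zero]
    · rw [coeff_add, coeff_add, (ha' u).2 hu, (hb' u).2 hu]
  | smul a x _ hx =>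
    rw [smul_eq_mul]
    induction a using MvPolynomial.induction_on' with
    | monomial v c =>
      intro d
      obtain ⟨a, ha, ha'⟩ := hx (d - wt ω v)
      refine ⟨monomial v c * a, I.mul_mem_left _ ha, fun u => ?_⟩
      rw [coeff_monomial_mul', coeff_monomial_mul']
      by_cases h : v ≤ u
      · have e : wt ω u = wt ω v + wt ω (u - v) := by
          rw [← wt_add, add_tsub_cancel_of_le h]
        simp only [if_pos h]
        refine ⟨fun hu => ?_, fun hu => ?_⟩
        · rw [(ha' (u - v)).1 (by linarith), mul_zero]
        · rw [(ha' (u - v)).2 (by linarith)]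
      · simp [h]
    | add p q hp hq =>
      intro d
      obtain ⟨a, ha, ha'⟩ := hp d
      obtain ⟨b, hb, hb'⟩ := hq d
      refine ⟨a + b, I.add_mem ha hb, fun u => ⟨fun hu => ?_, fun hu => ?_⟩⟩
      · rw [coeff_add, (ha' u).1 hu, (hb' u).1 hu, add_zero]
      · rw [add_mul, coeff_add, coeff_add, (ha' u).2 hu, (hb' u).2 hu]

lemma mem_of_lead {n : ℕ} (ω : Fin n → ℝ) (I : Ideal (MvPolynomial (Fin n) ℂ)) (d : ℝ)
    (f g : MvPolynomial (Fin n) ℂ) (hf : Hom' ω d f) (hg : g ∈ I) (h : Lead ω d f g) :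
    f ∈ initialIdeal ω I := by
  classical
  by_cases hf0 : f = 0
  · subst hf0; exact Ideal.zero_mem _
  obtain ⟨m, hm⟩ := MvPolynomial.ne_zero_iff.1 hf0
  have hmd : wt ω m = d := by
    by_contra hc
    exact hm (hf m hc)
  have hgm : g.coeff m ≠ 0 := by rw [(h m).2 hmd]; exact hm
  refine Ideal.subset_span ⟨g, hg, MvPolynomial.ne_zero_iff.2 ⟨m, hgm⟩, ?_⟩
  ext u
  rw [coeff_initialForm]
  split_ifs with hu
  · have h1 := hu m (by simpa using hgm)
    rcases h1.lt_or_eq with h2 | h2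
    · rw [(h u).1 (by linarith), hf u (by intro h3; linarith)]
    · rw [(h u).2 (by linarith)]
  · apply hf u
    intro hud
    apply hu
    intro v hv
    by_contra hc
    exact (mem_support_iff.1 hv) ((h v).1 (by linarith))

lemma hom_mul {n : ℕ} (ω : Fin n → ℝ) (d e : ℝ) (f f' : MvPolynomial (Fin n) ℂ)
    (hf : Hom' ω d f) (hf' : Hom' ω e f') : Hom' ω (d + e) (f * f') := by
  classical
  intro u hu
  rw [coeff_mul]
  refine Finset.sum_eq_zero fun p hp => ?_
  have hw : wt ω u = wt ω p.1 + wt ω p.2 := by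
    rw [← wt_add, Finset.HasAntidiagonal.mem_antidiagonal.1 hp]
  by_cases h1 : wt ω p.1 = d
  · rw [hf' p.2 (by intro h2; exact hu (by linarith)), mul_zero]
  · rw [hf _ h1, zero_mul]

lemma lead_mul {n : ℕ} (ω : Fin n → ℝ) (d e : ℝ) (f f' g g' : MvPolynomial (Fin n) ℂ)
    (hf : Hom' ω d f) (hf' : Hom' ω e f') (h : Lead ω d f g) (h' : Lead ω e f' g') :
    Lead ω (d + e) (f * f') (g * g') := by
  classical
  intro u
  have hw : ∀ p ∈ Finset.HasAntidiagonal.antidiagonal u, wt ω u = wt ω p.1 + wt ω p.2 := fun p hp => by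
    rw [← wt_add, Finset.HasAntidiagonal.mem_antidiagonal.1 hp]
  rw [coeff_mul, coeff_mul]
  refine ⟨fun hu => Finset.sum_eq_zero fun p hp => ?_, fun hu => Finset.sum_congr rfl fun p hp => ?_⟩
  · have := hw p hp
    by_cases h1 : d < wt ω p.1
    · rw [(h _).1 h1, zero_mul]
    · rw [(h' p.2).1 (by linarith), mul_zero]
  · have := hw p hp
    rcases lt_trichotomy d (wt ω p.1) with h1 | h1 | h1
    · rw [(h _).1 h1, hf _ h1.ne', zero_mul, zero_mul]
    · rw [(h _).2 h1.symm, (h' p.2).2 (by linarith)]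
    · have h2 : e < wt ω p.2 := by linarith
      rw [(h' _).1 h2, hf' _ h2.ne', mul_zero, mul_zero]

lemma lead_prod {n : ℕ} (ω : Fin n → ℝ) (d : ℝ) (f : MvPolynomial (Fin n) ℂ)
    (hf : Hom' ω d f) (r : ℕ) (g : Fin r → MvPolynomial (Fin n) ℂ)
    (h : ∀ j, Lead ω d f (g j)) :
    ∃ e, Hom' ω e (f ^ r) ∧ Lead ω e (f ^ r) (∏ j, g j) := by
  classical
  induction r with
  | zero =>
    refine ⟨0, fun u hu => ?_, fun u => ⟨fun hu => ?_, fun hu => by simp⟩⟩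
    all_goals
      have : (0 : Fin n →₀ ℕ) ≠ u := by
        rintro rfl
        simp [wt] at hu
      simp [coeff_one, this]
  | succ r ih =>
    obtain ⟨e, h1, h2⟩ := ih (fun j => g j.succ) (fun j => h _)
    refine ⟨d + e, ?_, ?_⟩
    · rw [pow_succ']; exact hom_mul _ _ _ _ _ hf h1
    · rw [pow_succ', Fin.prod_univ_succ]; exact lead_mul _ _ _ _ _ _ _ hf h1 (h 0) h2

lemma part1 {n : ℕ} (r : ℕ) (I : Fin r → Ideal (MvPolynomial (Fin n) ℂ)) (ω : Fin n → ℝ)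
    (d : ℝ) (f : MvPolynomial (Fin n) ℂ) (hf : Hom' ω d f)
    (h : ∀ j, ∃ g ∈ I j, Lead ω d f g) : f ^ r ∈ initialIdeal ω (⨅ j, I j) := by
  choose g hg hl using h
  obtain ⟨e, h1, h2⟩ := lead_prod ω d f hf r g hl
  refine mem_of_lead ω _ e _ _ h1 ?_ h2
  rw [Ideal.mem_iInf]
  intro j
  exact Ideal.mem_of_dvd _ (Finset.dvd_prod_of_mem g (Finset.mem_univ j)) (hg j)

/-- If `f` is `ω`-homogeneous and `f ∈ in_ω(I_j)` for every `j = 1,…,r`, then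
`f^r ∈ in_ω(⋂_j I_j)`; consequently `⋂_j in_ω(I_j) ⊆ √(in_ω(⋂_j I_j))`. -/
theorem pow_mem_initialIdeal_inf_of_wHomogeneous
    {n : ℕ} (r : ℕ) (I : Fin r → Ideal (MvPolynomial (Fin n) ℂ)) (ω : Fin n → ℝ) :
    (∀ f : MvPolynomial (Fin n) ℂ, IsWHomogeneous ω f →
        (∀ j, f ∈ initialIdeal ω (I j)) → f ^ r ∈ initialIdeal ω (⨅ j, I j)) ∧
    (⨅ j, initialIdeal ω (I j)) ≤ (initialIdeal ω (⨅ j, I j)).radical := by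
  classical
  refine ⟨fun f hf h => ?_, fun f hf => ?_⟩
  · have : ∃ d, Hom' ω d f := by
      by_cases hf0 : f = 0
      · exact ⟨0, fun u _ => by simp [hf0]⟩
      obtain ⟨m, hm⟩ := MvPolynomial.ne_zero_iff.1 hf0
      refine ⟨wt ω m, fun u hu => ?_⟩
      by_contra hc
      exact hu (hf u (by simpa using hc) m (by simpa using hm))
    obtain ⟨d, hd⟩ := this
    exact part1 r I ω d f hd fun j => lead_of_mem ω _ f (h j) d
  · rw [Ideal.mem_iInf] at hf
    rw [f.as_sum, ← Finset.sum_fiberwise_of_maps_to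
      (fun u hu => Finset.mem_image_of_mem (wt ω) hu)]
    refine Ideal.sum_mem _ fun d _ => ⟨r, ?_⟩
    have hc : ∀ u, coeff u (∑ v ∈ f.support with wt ω v = d, monomial v (f.coeff v)) =
        if wt ω u = d then f.coeff u else 0 := by
      intro u
      rw [coeff_sum]
      simp only [coeff_monomial]
      rw [Finset.sum_ite_eq']
      by_cases h : f.coeff u = 0
      · simp [h]
      · simp [h]
    refine part1 r I ω d _ (fun u hu => by rw [hc, if_neg hu]) fun j => ?_
    obtain ⟨g, hg, hl⟩ := lead_of_mem ω _ f (hf j) d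
    exact ⟨g, hg, fun u => ⟨(hl u).1, fun hu => by rw [hc, if_pos hu]; exact (hl u).2 hu⟩⟩
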